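/- Let ℒ be the Laplacian tensor of a weighted k-uniform hypergraph on Fin n, and suppose (λ, x) is a Z-eigenpair of ℒ with unit eigenvector: ℒ x^{k−1} = λ • x and xᵀx = 1. Then the eigenvalue decomposes as the sum of per-hyperedge scores: λ = ℒ x^k = Σ_{e ∈ E} w e · ( Σ_{i ∈ e} (x i)^k − k · ∏_{i ∈ e} x i ). -/

import Mathlib

open Finset

/-- Degree of vertex `i` in a weighted hypergraph `(E, w)`. -/
noncomputable def deg {n : ℕ} (E : Finset (Finset (Fin n))) (w : Finset (Fin n) → ℝ)
    (i : Fin n) : ℝ :=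
  ∑ e ∈ E.filter (fun e => i ∈ e), w e

/-- Adjacency tensor of a weighted `k`-uniform hypergraph. -/
noncomputable def adjT {n : ℕ} (E : Finset (Finset (Fin n))) (w : Finset (Fin n) → ℝ)
    (k : ℕ) (σ : Fin k → Fin n) : ℝ :=
  if Function.Injective σ ∧ Finset.image σ Finset.univ ∈ E then
    w (Finset.image σ Finset.univ) / (Nat.factorial (k - 1)) else 0

/-- Laplacian tensor `𝒟 - 𝒜`. -/
noncomputable def lapT {n : ℕ} (E : Finset (Finset (Fin n))) (w : Finset (Fin n) → ℝ)
    (k : ℕ) (σ : Fin k → Fin n) : ℝ :=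
  (∑ i : Fin n, if σ = Function.const (Fin k) i then deg E w i else 0) - adjT E w k σ

/-- The tuple `(i, τ₁, …, τ_{k-1})`. -/
def consT {n : ℕ} (k : ℕ) (i : Fin n) (τ : Fin (k - 1) → Fin n) : Fin k → Fin n :=
  fun t => if ht : t.val = 0 then i else τ ⟨t.val - 1, by have := t.isLt; omega⟩

/-- The Laplacian form `ℒ x^k`. -/
noncomputable def lapForm {n : ℕ} (E : Finset (Finset (Fin n))) (w : Finset (Fin n) → ℝ)
    (k : ℕ) (x : Fin n → ℝ) : ℝ :=
  ∑ σ : Fin k → Fin n, lapT E w k σ * ∏ t, x (σ t)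

/-- The number of injective tuples enumerating a finite set `e` is `(#e)!`. -/
theorem card_injective_image_eq {α : Type*} [Fintype α] [DecidableEq α] (k : ℕ) (e : Finset α)
    (he : e.card = k) :
    (univ.filter fun σ : Fin k → α =>
      Function.Injective σ ∧ Finset.image σ univ = e).card = k.factorial := by
  have hc : Fintype.card (Fin k) = Fintype.card e := by simp [he]
  have h := Fintype.card_equiv (Fintype.equivOfCardEq hc)
  rw [Fintype.card_fin] at h
  rw [← h, ← Finset.card_univ]
  symm
  refine Finset.card_bij (fun f _ t => (f t : α)) ?_ ?_ ?_
  · intro f _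
    simp only [mem_filter, mem_univ, true_and]
    refine ⟨Subtype.val_injective.comp f.injective, ?_⟩
    ext a
    simp only [mem_image, mem_univ, true_and]
    constructor
    · rintro ⟨t, rfl⟩
      exact (f t).2
    · intro ha
      exact ⟨f.symm ⟨a, ha⟩, by simp⟩
  · intro f _ g _ hfg
    ext t
    exact congrFun hfg t
  · intro σ hσ
    simp only [mem_filter, mem_univ, true_and] at hσ
    obtain ⟨hinj, himg⟩ := hσ
    have hmem : ∀ t, σ t ∈ e := fun t => himg ▸ mem_image_of_mem σ (mem_univ t)
    refine ⟨Equiv.ofBijective (fun t => (⟨σ t, hmem t⟩ : e)) ⟨?_, ?_⟩, mem_univ _, rfl⟩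
    · intro a b hab
      exact hinj (congrArg Subtype.val hab)
    · rintro ⟨a, ha⟩
      rw [← himg] at ha
      obtain ⟨t, -, ht⟩ := mem_image.mp ha
      exact ⟨t, Subtype.ext ht⟩

theorem consT_succ {n : ℕ} (m : ℕ) (i : Fin n) (τ : Fin m → Fin n) :
    consT (m + 1) i τ = Fin.cons i τ := by
  funext t
  refine Fin.cases ?_ (fun j => ?_) t
  · simp [consT]
  · simp [consT]

/-- Expansion of the Laplacian form along its first index. -/
theorem lapForm_eq_sum_mul {n : ℕ} (E : Finset (Finset (Fin n))) (w : Finset (Fin n) → ℝ)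
    (k : ℕ) (hk : k ≠ 0) (x : Fin n → ℝ) :
    lapForm E w k x =
      ∑ i, x i * ∑ τ : Fin (k - 1) → Fin n, lapT E w k (consT k i τ) * ∏ t, x (τ t) := by
  obtain ⟨m, rfl⟩ := Nat.exists_eq_succ_of_ne_zero hk
  rw [lapForm, ← (Fin.consEquiv fun _ : Fin (m + 1) => Fin n).sum_comp, Fintype.sum_prod_type]
  refine Finset.sum_congr rfl fun i _ => ?_
  rw [Finset.mul_sum]
  refine Finset.sum_congr rfl fun τ _ => ?_
  have h : consT m.succ i τ = Fin.cons i τ := consT_succ m i τ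
  rw [h]
  simp only [Fin.consEquiv, Equiv.coe_fn_mk, Fin.prod_univ_succ, Fin.cons_zero, Fin.cons_succ]
  exact mul_left_comm _ _ _

/-- The degree part of the Laplacian form, as a sum over hyperedges. -/
theorem sum_deg_mul {n : ℕ} (E : Finset (Finset (Fin n))) (w : Finset (Fin n) → ℝ)
    (f : Fin n → ℝ) :
    ∑ i, deg E w i * f i = ∑ e ∈ E, w e * ∑ i ∈ e, f i := by
  simp only [deg, Finset.sum_filter, Finset.sum_mul, Finset.mul_sum]
  rw [Finset.sum_comm]
  refine Finset.sum_congr rfl fun e _ => ?_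
  simp [ite_mul, Finset.sum_ite_mem]

/-- The adjacency form, as a sum over hyperedges. -/
theorem sum_adjT_mul_prod {n : ℕ} (E : Finset (Finset (Fin n))) (w : Finset (Fin n) → ℝ)
    (k : ℕ) (hk : k ≠ 0) (hcard : ∀ e ∈ E, e.card = k) (x : Fin n → ℝ) :
    ∑ σ : Fin k → Fin n, adjT E w k σ * ∏ t, x (σ t) =
      ∑ e ∈ E, w e * (k * ∏ i ∈ e, x i) := by
  have h : ∀ σ : Fin k → Fin n, adjT E w k σ * ∏ t, x (σ t) =
      ∑ e ∈ E, if Function.Injective σ ∧ Finset.image σ univ = e then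
        w e / (k - 1).factorial * ∏ i ∈ e, x i else 0 := by
    intro σ
    by_cases hσ : Function.Injective σ
    · simp only [adjT, hσ, true_and, Finset.sum_ite_eq]
      split_ifs
      · rw [Finset.prod_image fun a _ b _ hab => hσ hab]
      · simp
    · simp [adjT, hσ]
  rw [Finset.sum_congr rfl fun σ _ => h σ, Finset.sum_comm]
  refine Finset.sum_congr rfl fun e he => ?_
  rw [← Finset.sum_filter, Finset.sum_const, card_injective_image_eq k e (hcard e he),
    nsmul_eq_mul, ← Nat.mul_factorial_pred hk]
  have hpos : ((k - 1).factorial : ℝ) ≠ 0 := by positivity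
  push_cast
  field_simp

/-- The Laplacian form is the sum of the hyperedge scores. -/
theorem lapForm_eq_sum_hyperedge_scores {n : ℕ} (E : Finset (Finset (Fin n)))
    (w : Finset (Fin n) → ℝ) (k : ℕ) (hk : k ≠ 0) (hcard : ∀ e ∈ E, e.card = k)
    (x : Fin n → ℝ) :
    lapForm E w k x = ∑ e ∈ E, w e * (∑ i ∈ e, x i ^ k - k * ∏ i ∈ e, x i) := by
  simp only [lapForm, lapT, sub_mul, mul_sub, Finset.sum_sub_distrib]
  rw [sum_adjT_mul_prod E w k hk hcard x, ← sum_deg_mul E w fun i => x i ^ k]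
  congr 1
  simp only [Finset.sum_mul]
  rw [Finset.sum_comm]
  refine Finset.sum_congr rfl fun i _ => ?_
  simp [ite_mul]

/-- a Z-eigenvalue with unit eigenvector equals the Laplacian form, which
decomposes as the sum of per-hyperedge scores. -/
theorem eigenvalue_eq_sum_hyperedge_scores
    (n k : ℕ) (hn : 1 ≤ n) (hk : 2 ≤ k)
    (E : Finset (Finset (Fin n))) (w : Finset (Fin n) → ℝ)
    (hcard : ∀ e ∈ E, e.card = k) (hw : ∀ e ∈ E, 0 < w e)
    (lam : ℝ) (x : Fin n → ℝ)
    (hpair : ∀ i : Fin n,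
      ∑ τ : Fin (k - 1) → Fin n, lapT E w k (consT k i τ) * ∏ t, x (τ t) = lam * x i)
    (hunit : ∑ i, x i * x i = 1) :
    lam = lapForm E w k x ∧
    lapForm E w k x = ∑ e ∈ E, w e * (∑ i ∈ e, x i ^ k - k * ∏ i ∈ e, x i) := by
  have hk0 : k ≠ 0 := by lia
  refine ⟨?_, lapForm_eq_sum_hyperedge_scores E w k hk0 hcard x⟩
  rw [lapForm_eq_sum_mul E w k hk0 x]
  simp only [hpair]
  calc lam = lam * ∑ i, x i * x i := by rw [hunit, mul_one]
    _ = ∑ i, x i * (lam * x i) := by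
      rw [Finset.mul_sum]
      exact Finset.sum_congr rfl fun i _ => mul_left_comm _ _ _
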